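/- arXiv:2101.04479 — 2 statements merged into one kernel-verified Lean document; each statement's English description precedes it below -/
import Mathlib

section
/- The monic polynomials G_n(z) = (n!(b_1)_n⋯(b_q)_n/((a_1)_n⋯(a_p)_n)) · g_n(z) satisfy the R_I-type recurrence G_n(z) = (z + δ_n) G_{n−1}(z) − δ_{n−1} z G_{n−2}(z) for all n ≥ 1, where G_{−1}(z) := 0, δ_0 := 0, and δ_k := k(b_1+k−1)⋯(b_q+k−1)/((a_1+k−1)⋯(a_p+k−1)) for k ≥ 1 (identity of polynomials in z). -/
open Complex Finset

/-- The Pochhammer symbol `(c)_k = c (c+1) ⋯ (c+k-1)`. -/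
noncomputable def poch (c : ℂ) (k : ℕ) : ℂ := ∏ i ∈ Finset.range k, (c + (i : ℂ))

/-- Coefficient of `z^k` in the generalized hypergeometric series. -/
noncomputable def hypCoeff (p q : ℕ) (a : Fin p → ℂ) (b : Fin q → ℂ) (k : ℕ) : ℂ :=
  (∏ j, poch (a j) k) / ((∏ l, poch (b l) k) * (k.factorial : ℂ))

/-- `g_n(z)`: the `n`-th partial sum of the generalized hypergeometric series. -/
noncomputable def g (p q : ℕ) (a : Fin p → ℂ) (b : Fin q → ℂ) (n : ℕ) (z : ℂ) : ℂ :=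
  ∑ k ∈ Finset.range (n + 1), hypCoeff p q a b k * z ^ k

/-- The monic polynomials `G_n(z) = (n! (b_1)_n ⋯ (b_q)_n / ((a_1)_n ⋯ (a_p)_n)) g_n(z)`. -/
noncomputable def G (p q : ℕ) (a : Fin p → ℂ) (b : Fin q → ℂ) (n : ℕ) (z : ℂ) : ℂ :=
  ((n.factorial : ℂ) * (∏ l, poch (b l) n) / (∏ j, poch (a j) n)) * g p q a b n z

/-- `δ_0 = 0` and `δ_k = k (b_1+k-1) ⋯ (b_q+k-1) / ((a_1+k-1) ⋯ (a_p+k-1))` for `k ≥ 1`. -/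
noncomputable def del (p q : ℕ) (a : Fin p → ℂ) (b : Fin q → ℂ) (k : ℕ) : ℂ :=
  if k = 0 then 0
  else (k : ℂ) * (∏ l, (b l + (k : ℂ) - 1)) / (∏ j, (a j + (k : ℂ) - 1))

theorem poch_succ (c : ℂ) (k : ℕ) : poch c (k + 1) = poch c k * (c + k) :=
  Finset.prod_range_succ _ _

theorem poch_ne_zero {c : ℂ} (hc : ∀ m : ℕ, c ≠ -(m : ℂ)) (k : ℕ) : poch c k ≠ 0 :=
  Finset.prod_ne_zero_iff.mpr fun i _ h => hc i (eq_neg_of_add_eq_zero_left h)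

theorem G_zero (p q : ℕ) (a : Fin p → ℂ) (b : Fin q → ℂ) (z : ℂ) : G p q a b 0 z = 1 := by
  simp [G, g, hypCoeff, poch]

theorem del_succ (p q : ℕ) (a : Fin p → ℂ) (b : Fin q → ℂ) (n : ℕ) :
    del p q a b (n + 1) = ((n : ℂ) + 1) * (∏ l, (b l + (n : ℂ))) / ∏ j, (a j + (n : ℂ)) := by
  simp [del, ← add_assoc]

/-- The first-order inhomogeneous recurrence satisfied by the monic partial sums. -/
theorem G_succ (p q : ℕ) (a : Fin p → ℂ) (b : Fin q → ℂ)
    (ha : ∀ j, ∀ m : ℕ, a j ≠ -(m : ℂ)) (hb : ∀ l, ∀ m : ℕ, b l ≠ -(m : ℂ)) (n : ℕ) (z : ℂ) :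
    G p q a b (n + 1) z = z ^ (n + 1) + del p q a b (n + 1) * G p q a b n z := by
  have hA : ∏ j, poch (a j) n ≠ 0 :=
    Finset.prod_ne_zero_iff.mpr fun j _ => poch_ne_zero (ha j) n
  have hB : ∏ l, poch (b l) n ≠ 0 :=
    Finset.prod_ne_zero_iff.mpr fun l _ => poch_ne_zero (hb l) n
  have hA' : ∏ j, (a j + (n : ℂ)) ≠ 0 :=
    Finset.prod_ne_zero_iff.mpr fun j _ h => ha j n (eq_neg_of_add_eq_zero_left h)
  have hB' : ∏ l, (b l + (n : ℂ)) ≠ 0 :=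
    Finset.prod_ne_zero_iff.mpr fun l _ h => hb l n (eq_neg_of_add_eq_zero_left h)
  have hn : (n : ℂ) + 1 ≠ 0 := Nat.cast_add_one_ne_zero n
  have hf : (n.factorial : ℂ) ≠ 0 := Nat.cast_ne_zero.mpr n.factorial_ne_zero
  have hg : g p q a b (n + 1) z =
      g p q a b n z + hypCoeff p q a b (n + 1) * z ^ (n + 1) :=
    Finset.sum_range_succ _ _
  rw [G, G, hg, del_succ]
  simp only [hypCoeff, poch_succ, Finset.prod_mul_distrib, Nat.factorial_succ, Nat.cast_mul,
    Nat.cast_add, Nat.cast_one]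
  field_simp
  ring

theorem stmt1 (p q : ℕ) (a : Fin p → ℂ) (b : Fin q → ℂ)
    (ha : ∀ j, ∀ m : ℕ, a j ≠ -(m : ℂ)) (hb : ∀ l, ∀ m : ℕ, b l ≠ -(m : ℂ)) :
    ∀ n : ℕ, 1 ≤ n → ∀ z : ℂ,
      G p q a b n z = (z + del p q a b n) * G p q a b (n - 1) z
        - del p q a b (n - 1) * z * (if 2 ≤ n then G p q a b (n - 2) z else 0) := by
  intro n hn z
  match n, hn with
  | 1, _ =>
    rw [G_succ p q a b ha hb 0 z]
    simp [G_zero]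
  | n + 2, _ =>
    rw [show n + 2 - 1 = n + 1 from rfl, Nat.add_sub_cancel, if_pos (Nat.le_add_left 2 n),
      G_succ p q a b ha hb (n + 1) z]
    linear_combination (-z) * G_succ p q a b ha hb n z
end

section
/- For every n ≥ 0 and every real x < 0: g_n(x) = −(n+1) x^{n+1} ∫_{−∞}^x t^{−n−2} P_n(t) dt, where P_n(t) := ∑_{k=0}^n ((−n)_k (a_1)_k⋯(a_p)_k)/((−n−1)_k (b_1)_k⋯(b_q)_k) · t^k/k! is the terminating hypergeometric polynomial ₚ₊₁F_{q+1}(−n, a_1,…,a_p; −n−1, b_1,…,b_q; t). -/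
open Complex Finset

/-- The terminating hypergeometric polynomial
`P_n(t) = ₚ₊₁F_{q+1}(-n, a_1,…,a_p; -n-1, b_1,…,b_q; t)`. -/
noncomputable def Ppoly (p q : ℕ) (a : Fin p → ℂ) (b : Fin q → ℂ) (n : ℕ) (t : ℂ) : ℂ :=
  ∑ k ∈ Finset.range (n + 1),
    (poch (-(n : ℂ)) k * ∏ j, poch (a j) k) /
      (poch (-(n : ℂ) - 1) k * (∏ l, poch (b l) k) * (k.factorial : ℂ)) * t ^ k

theorem poch_sub_one_mul (c : ℂ) (k : ℕ) :
    poch (c - 1) k * (c - 1 + k) = (c - 1) * poch c k := by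
  unfold poch
  rw [← Finset.prod_range_succ (fun i : ℕ => c - 1 + (i : ℂ)), Finset.prod_range_succ', mul_comm]
  congr 1
  · simp
  · exact Finset.prod_congr rfl fun i _ => by push_cast; ring

theorem poch_neg_natCast_div {n k : ℕ} (hk : k ≤ n) :
    poch (-(n : ℂ)) k / poch (-(n : ℂ) - 1) k = ((n - k : ℕ) + 1 : ℂ) / (n + 1) := by
  have hne : poch (-(n : ℂ) - 1) k ≠ 0 := by
    refine Finset.prod_ne_zero_iff.mpr fun i hi h => ?_
    have hi' := Finset.mem_range.mp hi
    have : (i : ℂ) = ((n + 1 : ℕ) : ℂ) := by push_cast; linear_combination h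
    have := Nat.cast_injective this
    omega
  have hn : (n : ℂ) + 1 ≠ 0 := Nat.cast_add_one_ne_zero n
  rw [div_eq_div_iff hne hn, Nat.cast_sub hk]
  linear_combination poch_sub_one_mul (-(n : ℂ)) k

theorem integrableOn_Iic_zpow_of_lt {m : ℤ} (hm : m < -1) {x : ℝ} (hx : x < 0) :
    MeasureTheory.IntegrableOn (fun t : ℝ => (t : ℂ) ^ m) (Set.Iic x) := by
  have hpos : MeasureTheory.IntegrableOn (fun t : ℝ => t ^ m) (Set.Ioi (-x)) := by
    simpa using integrableOn_Ioi_rpow_of_lt (a := m) (c := -x) (by exact_mod_cast hm)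
      (neg_pos.mpr hx)
  have hneg : MeasureTheory.IntegrableOn (fun t : ℝ => (-t) ^ m) (Set.Iic x) := by
    have hmp := MeasureTheory.Measure.measurePreserving_neg
      (MeasureTheory.volume : MeasureTheory.Measure ℝ)
    have h := (hmp.integrableOn_comp_preimage (MeasurableEquiv.neg ℝ).measurableEmbedding).mpr
      ((integrableOn_Ici_iff_integrableOn_Ioi).mpr hpos)
    simpa [Function.comp_def] using h
  refine (hneg.ofReal (𝕜 := ℂ)).const_mul ((-1) ^ m) |>.congr (.of_forall fun t => ?_)
  simp [← mul_zpow]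

theorem integral_Iic_zpow_of_lt {m : ℤ} (hm : m < -1) {x : ℝ} (hx : x < 0) :
    ∫ t in Set.Iic x, (t : ℂ) ^ m = (x : ℂ) ^ (m + 1) / (m + 1) := by
  have hm1 : (m : ℂ) + 1 ≠ 0 := by
    have : m + 1 ≠ 0 := by omega
    exact_mod_cast this
  have hderiv : ∀ t ∈ Set.Iic x,
      HasDerivAt (fun t : ℝ => (t : ℂ) ^ (m + 1) / (m + 1)) ((t : ℂ) ^ m) t := by
    intro t ht
    have ht0 : (t : ℂ) ≠ 0 := by exact_mod_cast (lt_of_le_of_lt ht hx).ne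
    have h := ((hasDerivAt_zpow (m + 1) (t : ℂ) (.inl ht0)).comp_ofReal).div_const ((m : ℂ) + 1)
    rwa [Int.cast_add, Int.cast_one, add_sub_cancel_right, mul_div_cancel_left₀ _ hm1] at h
  have hlim : Filter.Tendsto (fun t : ℝ => (t : ℂ) ^ (m + 1) / (m + 1)) Filter.atBot
      (nhds 0) := by
    obtain ⟨j, hj⟩ : ∃ j : ℕ, m + 1 = -((j + 1 : ℕ) : ℤ) := ⟨(-m - 2).toNat, by omega⟩
    have h := (Complex.continuous_ofReal.tendsto 0).comp (tendsto_inv_atBot_zero (𝕜 := ℝ))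
    rw [hj]
    simp_rw [zpow_neg, zpow_natCast, ← inv_pow]
    simpa [Function.comp_def] using (h.pow (j + 1)).div_const ((m : ℂ) + 1)
  rw [MeasureTheory.integral_Iic_of_hasDerivAt_of_tendsto' hderiv
    (integrableOn_Iic_zpow_of_lt hm hx) hlim, sub_zero]

theorem stmt7 (p q : ℕ) (a : Fin p → ℂ) (b : Fin q → ℂ)
    (ha : ∀ j, ∀ m : ℕ, a j ≠ -(m : ℂ)) (hb : ∀ l, ∀ m : ℕ, b l ≠ -(m : ℂ)) :
    ∀ n : ℕ, ∀ x : ℝ, x < 0 →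
      g p q a b n (x : ℂ)
        = -((n : ℂ) + 1) * (x : ℂ) ^ (n + 1) *
            ∫ t in Set.Iic x, ((t : ℂ) ^ (-(n : ℤ) - 2)) * Ppoly p q a b n (t : ℂ) := by
  intro n x hx
  have hx0 : (x : ℂ) ≠ 0 := by exact_mod_cast hx.ne
  have hn : (n : ℂ) + 1 ≠ 0 := Nat.cast_add_one_ne_zero n
  have hlt : ∀ k ∈ Finset.range (n + 1), (k : ℤ) - n - 2 < -1 := fun k hk => by
    have := Finset.mem_range.mp hk
    omega
  have hint : ∫ t in Set.Iic x, ((t : ℂ) ^ (-(n : ℤ) - 2)) * Ppoly p q a b n (t : ℂ) =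
      ∑ k ∈ Finset.range (n + 1), hypCoeff p q a b k *
        (poch (-(n : ℂ)) k / poch (-(n : ℂ) - 1) k) *
          ∫ t in Set.Iic x, (t : ℂ) ^ ((k : ℤ) - n - 2) := by
    simp_rw [← MeasureTheory.integral_const_mul]
    rw [← MeasureTheory.integral_finsetSum _
      fun k hk => (integrableOn_Iic_zpow_of_lt (hlt k hk) hx).const_mul _]
    refine MeasureTheory.setIntegral_congr_fun measurableSet_Iic fun t ht => ?_
    have ht0 : (t : ℂ) ≠ 0 := by exact_mod_cast (lt_of_le_of_lt ht hx).ne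
    simp only [Ppoly, Finset.mul_sum, hypCoeff]
    refine Finset.sum_congr rfl fun k _ => ?_
    rw [show (k : ℤ) - n - 2 = (-(n : ℤ) - 2) + k by ring, zpow_add₀ ht0, zpow_natCast,
      div_mul_div_comm]
    ring
  rw [hint, Finset.mul_sum, g]
  refine Finset.sum_congr rfl fun k hk => ?_
  have hkn : k ≤ n := Nat.lt_succ_iff.mp (Finset.mem_range.mp hk)
  have hd : ((n - k : ℕ) : ℂ) + 1 ≠ 0 := Nat.cast_add_one_ne_zero _
  have hpow : (x : ℂ) ^ k = x ^ (n + 1) * (x : ℂ) ^ ((k : ℤ) - n - 2 + 1) := by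
    rw [← zpow_natCast, ← zpow_natCast, ← zpow_add₀ hx0]
    congr 1
    push_cast
    ring
  have hden : (((k : ℤ) - n - 2 : ℤ) : ℂ) + 1 = -(((n - k : ℕ) : ℂ) + 1) := by
    rw [Nat.cast_sub hkn]
    push_cast
    ring
  rw [integral_Iic_zpow_of_lt (hlt k hk) hx, poch_neg_natCast_div hkn, hpow, hden]
  field_simp
end
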